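/- Fix reals b, σ with σ ≠ 0, d > 0 and T ≥ 2d. There exists τ ∈ (0, d] such that the first-slice integral system admits a solution ξ = (ξ₁, ξ₂, ξ₃) on D_τ belonging to the ball B_τ, and this solution is the unique solution of the system within B_τ. -/

import Mathlib

open Set MeasureTheory

/-- Membership in the ball `B_τ`: continuity on `D_τ = [T-d-τ, T-d] × [-d,0]²` together
with the sup-norm bounds `‖ξ₁ - 1‖ ≤ 1/2`, `‖ξ₂ - b‖ ≤ |b|/2`, `‖ξ₃ - b²‖ ≤ b²/2`. -/
def memBall (b T d τ : ℝ) (ξ₁ : ℝ → ℝ) (ξ₂ : ℝ → ℝ → ℝ) (ξ₃ : ℝ → ℝ → ℝ → ℝ) : Prop :=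
  ContinuousOn ξ₁ (Icc (T - d - τ) (T - d)) ∧
  ContinuousOn (fun p : ℝ × ℝ => ξ₂ p.1 p.2) (Icc (T - d - τ) (T - d) ×ˢ Icc (-d) 0) ∧
  ContinuousOn (fun p : ℝ × ℝ × ℝ => ξ₃ p.1 p.2.1 p.2.2)
    (Icc (T - d - τ) (T - d) ×ˢ Icc (-d) 0 ×ˢ Icc (-d) 0) ∧
  (∀ t ∈ Icc (T - d - τ) (T - d), |ξ₁ t - 1| ≤ 1 / 2) ∧
  (∀ t ∈ Icc (T - d - τ) (T - d), ∀ s ∈ Icc (-d) 0, |ξ₂ t s - b| ≤ |b| / 2) ∧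
  (∀ t ∈ Icc (T - d - τ) (T - d), ∀ s ∈ Icc (-d) 0, ∀ r ∈ Icc (-d) 0,
    |ξ₃ t s r - b ^ 2| ≤ b ^ 2 / 2)

/-- The first-slice integral system on `D_τ = [T-d-τ, T-d] × [-d,0]²`. -/
def isSolutionOn (b σ T d τ : ℝ) (ξ₁ : ℝ → ℝ) (ξ₂ : ℝ → ℝ → ℝ) (ξ₃ : ℝ → ℝ → ℝ → ℝ) : Prop :=
  ∀ t ∈ Icc (T - d - τ) (T - d), ∀ s ∈ Icc (-d) 0, ∀ r ∈ Icc (-d) 0,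
    ξ₁ t = 1 - (σ ^ 2)⁻¹ * ∫ x in t..(T - d), (ξ₂ x 0) ^ 2 ∧
    ξ₂ t s = b * ξ₁ (min (T - d) (t + s + d)) -
      (σ ^ 2)⁻¹ * ∫ x in t..(min (T - d) (t + s + d)), ξ₂ x 0 * ξ₃ x (t + s - x) 0 ∧
    ξ₃ t s r = b * ξ₂ (min (T - d) (t + min s r + d)) (|s - r| - d) -
      (σ ^ 2)⁻¹ * ∫ x in t..(min (T - d) (t + min s r + d)),
        ξ₃ x (t + s - x) 0 * ξ₃ x 0 (t + r - x)

namespace FirstSlice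

noncomputable def G1 (c A : ℝ) (g₂ : ℝ → ℝ → ℝ) (t : ℝ) : ℝ :=
  1 - c * ∫ x in t..A, (g₂ x 0) ^ 2

noncomputable def G2 (b c A d : ℝ) (g₂ : ℝ → ℝ → ℝ) (g₃ : ℝ → ℝ → ℝ → ℝ) (t s : ℝ) : ℝ :=
  b * G1 c A g₂ (min A (t + s + d)) -
    c * ∫ x in t..(min A (t + s + d)), g₂ x 0 * g₃ x (t + s - x) 0

noncomputable def G3 (b c A d : ℝ) (g₂ : ℝ → ℝ → ℝ) (g₃ : ℝ → ℝ → ℝ → ℝ) (t s r : ℝ) : ℝ :=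
  b * G2 b c A d g₂ g₃ (min A (t + min s r + d)) (|s - r| - d) -
    c * ∫ x in t..(min A (t + min s r + d)), g₃ x (t + s - x) 0 * g₃ x 0 (t + r - x)

lemma cont_int {X : Type*} [TopologicalSpace X] {f : X → ℝ → ℝ}
    (hf : Continuous (Function.uncurry f)) {u v : X → ℝ} (hu : Continuous u)
    (hv : Continuous v) : Continuous fun p => ∫ x in (u p)..(v p), f p x := by
  have h1 := intervalIntegral.continuous_parametric_intervalIntegral_of_continuous
    (μ := volume) (a₀ := 0) hf hu
  have h2 := intervalIntegral.continuous_parametric_intervalIntegral_of_continuous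
    (μ := volume) (a₀ := 0) hf hv
  refine (h2.sub h1).congr fun p => ?_
  have hc : Continuous (f p) := hf.comp (Continuous.prodMk_right p)
  exact intervalIntegral.integral_interval_sub_left (hc.intervalIntegrable _ _)
    (hc.intervalIntegrable _ _)

section
variable {b c A d τ : ℝ} {g₂ h₂ : ℝ → ℝ → ℝ} {g₃ h₃ : ℝ → ℝ → ℝ → ℝ}

lemma cont_G1 (hg₂ : Continuous fun p : ℝ × ℝ => g₂ p.1 p.2) : Continuous (G1 c A g₂) := by
  unfold G1
  refine continuous_const.sub (continuous_const.mul ?_)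
  refine cont_int (f := fun _ x => (g₂ x 0) ^ 2) ?_ continuous_id continuous_const
  exact (hg₂.comp (continuous_snd.prodMk continuous_const)).pow 2

lemma cont_G2 (hg₂ : Continuous fun p : ℝ × ℝ => g₂ p.1 p.2)
    (hg₃ : Continuous fun p : ℝ × ℝ × ℝ => g₃ p.1 p.2.1 p.2.2) :
    Continuous (fun p : ℝ × ℝ => G2 b c A d g₂ g₃ p.1 p.2) := by
  unfold G2
  refine (continuous_const.mul ((cont_G1 hg₂).comp (by fun_prop))).sub (continuous_const.mul ?_)
  refine cont_int (f := fun (p : ℝ × ℝ) x => g₂ x 0 * g₃ x (p.1 + p.2 - x) 0) ?_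
    (by fun_prop) (by fun_prop)
  refine Continuous.mul (hg₂.comp (continuous_snd.prodMk continuous_const)) ?_
  exact hg₃.comp (g := fun p : ℝ × ℝ × ℝ => g₃ p.1 p.2.1 p.2.2)
    (f := fun q : (ℝ × ℝ) × ℝ => (q.2, q.1.1 + q.1.2 - q.2, (0:ℝ))) (by fun_prop)

lemma cont_G3 (hg₂ : Continuous fun p : ℝ × ℝ => g₂ p.1 p.2)
    (hg₃ : Continuous fun p : ℝ × ℝ × ℝ => g₃ p.1 p.2.1 p.2.2) :
    Continuous (fun p : ℝ × ℝ × ℝ => G3 b c A d g₂ g₃ p.1 p.2.1 p.2.2) := by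
  unfold G3
  refine (continuous_const.mul ((cont_G2 hg₂ hg₃).comp
    (f := fun p : ℝ × ℝ × ℝ => (min A (p.1 + min p.2.1 p.2.2 + d), |p.2.1 - p.2.2| - d))
    (by fun_prop))).sub (continuous_const.mul ?_)
  refine cont_int (f := fun (p : ℝ × ℝ × ℝ) x =>
    g₃ x (p.1 + p.2.1 - x) 0 * g₃ x 0 (p.1 + p.2.2 - x)) ?_ (by fun_prop) (by fun_prop)
  refine Continuous.mul ?_ ?_
  · exact hg₃.comp (g := fun p : ℝ × ℝ × ℝ => g₃ p.1 p.2.1 p.2.2)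
      (f := fun q : (ℝ × ℝ × ℝ) × ℝ => (q.2, q.1.1 + q.1.2.1 - q.2, (0:ℝ))) (by fun_prop)
  · exact hg₃.comp (g := fun p : ℝ × ℝ × ℝ => g₃ p.1 p.2.1 p.2.2)
      (f := fun q : (ℝ × ℝ × ℝ) × ℝ => (q.2, (0:ℝ), q.1.1 + q.1.2.2 - q.2)) (by fun_prop)

lemma int_bound {f : ℝ → ℝ} {a m C : ℝ} (ham : a ≤ m) (hm : m - a ≤ τ) (hC : 0 ≤ C)
    (hf : ∀ x, |f x| ≤ C) : |∫ x in a..m, f x| ≤ C * τ := by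
  have h := intervalIntegral.norm_integral_le_of_norm_le_const (a := a) (b := m) (f := f) (C := C)
    (fun x _ => hf x)
  rw [Real.norm_eq_abs, abs_of_nonneg (sub_nonneg.2 ham)] at h
  exact h.trans (by gcongr)

lemma int_diff {f g : ℝ → ℝ} {a m C : ℝ} (hfc : Continuous f) (hgc : Continuous g)
    (ham : a ≤ m) (hm : m - a ≤ τ) (hC : 0 ≤ C)
    (hf : ∀ x, |f x - g x| ≤ C) : |(∫ x in a..m, f x) - ∫ x in a..m, g x| ≤ C * τ := by
  rw [← intervalIntegral.integral_sub (hfc.intervalIntegrable _ _) (hgc.intervalIntegrable _ _)]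
  exact int_bound ham hm hC hf

lemma mul_bound {x y X Y : ℝ} (hx : |x| ≤ X) (hy : |y| ≤ Y) : |x * y| ≤ X * Y := by
  rw [abs_mul]
  exact mul_le_mul hx hy (abs_nonneg _) ((abs_nonneg _).trans hx)

lemma mul_diff {x y x' y' X Y δ : ℝ} (hx : |x| ≤ X) (hy : |y'| ≤ Y) (h1 : |x - x'| ≤ δ)
    (h2 : |y - y'| ≤ δ) : |x * y - x' * y'| ≤ (X + Y) * δ := by
  have e : x * y - x' * y' = x * (y - y') + (x - x') * y' := by ring
  rw [e]
  refine (abs_add_le _ _).trans ?_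
  have := mul_bound hx h2
  have := mul_bound h1 hy
  linarith

/-- Combining an affine term and an integral term. -/
lemma comb {b c u v I P Q : ℝ} (hc : 0 ≤ c) (hu : |u - v| ≤ P) (hI : |I| ≤ Q) :
    |b * u - c * I - b * v| ≤ |b| * P + c * Q := by
  have e : b * u - c * I - b * v = b * (u - v) - c * I := by ring
  rw [e]
  refine (abs_sub _ _).trans ?_
  rw [abs_mul, abs_mul, abs_of_nonneg hc]
  gcongr

lemma comb2 {b c u v I J P Q : ℝ} (hc : 0 ≤ c) (hu : |u - v| ≤ P) (hI : |I - J| ≤ Q) :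
    |(b * u - c * I) - (b * v - c * J)| ≤ |b| * P + c * Q := by
  have := comb (b := b) hc hu hI
  rwa [show (b * u - c * I) - (b * v - c * J) = b * u - c * (I - J) - b * v by ring]

lemma dom2 {t s : ℝ} (ht : t ∈ Icc (A - τ) A) (hs : s ∈ Icc (-d) 0) :
    t ≤ min A (t + s + d) ∧ min A (t + s + d) ∈ Icc (A - τ) A ∧ min A (t + s + d) - t ≤ τ := by
  have h : t ≤ min A (t + s + d) := le_min ht.2 (by linarith [hs.1])
  have h' := min_le_left A (t + s + d)
  exact ⟨h, ⟨ht.1.trans h, h'⟩, by linarith [ht.1]⟩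

lemma dmin {s r : ℝ} (hs : s ∈ Icc (-d) 0) (hr : r ∈ Icc (-d) 0) :
    min s r ∈ Icc (-d) 0 := ⟨le_min hs.1 hr.1, (min_le_left _ _).trans hs.2⟩

lemma dabs {s r : ℝ} (hs : s ∈ Icc (-d) 0) (hr : r ∈ Icc (-d) 0) :
    |s - r| - d ∈ Icc (-d) 0 := by
  refine ⟨by linarith [abs_nonneg (s - r)], ?_⟩
  have : |s - r| ≤ d := abs_le.2 ⟨by linarith [hs.1, hr.2], by linarith [hs.2, hr.1]⟩
  linarith

lemma bound_of {x y z : ℝ} (h : |x - y| ≤ z) : |x| ≤ |y| + z := by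
  have := abs_add_le (x - y) y
  simp only [sub_add_cancel] at this
  linarith

lemma G1_bound (hc : 0 ≤ c) (hg₂ : ∀ t s, |g₂ t s| ≤ 3 / 2 * |b|) {t : ℝ}
    (ht : t ∈ Icc (A - τ) A) : |G1 c A g₂ t - 1| ≤ c * (9 / 4 * b ^ 2 * τ) := by
  unfold G1
  rw [sub_sub_cancel_left, abs_neg, abs_mul, abs_of_nonneg hc]
  gcongr
  refine int_bound ht.2 (by linarith [ht.1]) (by positivity) fun x => ?_
  have := mul_bound (hg₂ x 0) (hg₂ x 0)
  rw [pow_two, ← sq_abs b]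
  linarith

lemma G2_bound (hc : 0 ≤ c) (hg₂ : ∀ t s, |g₂ t s| ≤ 3 / 2 * |b|)
    (hg₃ : ∀ t s r, |g₃ t s r| ≤ 3 / 2 * b ^ 2) {t s : ℝ}
    (ht : t ∈ Icc (A - τ) A) (hs : s ∈ Icc (-d) 0) :
    |G2 b c A d g₂ g₃ t s - b| ≤ |b| * (2 * (c * (9 / 4 * b ^ 2 * τ))) := by
  obtain ⟨h1, h2, h3⟩ := dom2 (d := d) ht hs
  have hb := G1_bound (b := b) hc hg₂ h2
  have hI := int_bound h1 h3 (f := fun x => g₂ x 0 * g₃ x (t + s - x) 0)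
    (C := (3 / 2 * |b|) * (3 / 2 * b ^ 2)) (by positivity)
    (fun x => mul_bound (hg₂ _ _) (hg₃ _ _ _))
  have := comb (b := b) hc hb hI
  rw [mul_one] at this
  unfold G2
  refine this.trans (le_of_eq ?_)
  ring

lemma G3_bound (hc : 0 ≤ c) (hg₂ : ∀ t s, |g₂ t s| ≤ 3 / 2 * |b|)
    (hg₃ : ∀ t s r, |g₃ t s r| ≤ 3 / 2 * b ^ 2) {t s r : ℝ}
    (ht : t ∈ Icc (A - τ) A) (hs : s ∈ Icc (-d) 0) (hr : r ∈ Icc (-d) 0) :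
    |G3 b c A d g₂ g₃ t s r - b ^ 2| ≤ b ^ 2 * (3 * (c * (9 / 4 * b ^ 2 * τ))) := by
  obtain ⟨h1, h2, h3⟩ := dom2 (d := d) ht (dmin hs hr)
  have hb := G2_bound (b := b) hc hg₂ hg₃ h2 (dabs hs hr)
  have hI := int_bound h1 h3 (f := fun x => g₃ x (t + s - x) 0 * g₃ x 0 (t + r - x))
    (C := (3 / 2 * b ^ 2) * (3 / 2 * b ^ 2)) (by positivity)
    (fun x => mul_bound (hg₃ _ _ _) (hg₃ _ _ _))
  have := comb (b := b) hc hb hI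
  rw [← pow_two] at this
  unfold G3
  refine this.trans (le_of_eq ?_)
  have : |b| * (|b| * (2 * (c * (9 / 4 * b ^ 2 * τ)))) = |b| ^ 2 * (2 * (c * (9 / 4 * b ^ 2 * τ))) := by
    ring
  rw [this, sq_abs]
  ring

variable {M N δ : ℝ}

lemma G1_diff (hc : 0 ≤ c) (hM : 0 ≤ M) (hδ : 0 ≤ δ)
    (cg₂ : Continuous fun p : ℝ × ℝ => g₂ p.1 p.2)
    (ch₂ : Continuous fun p : ℝ × ℝ => h₂ p.1 p.2)
    (hg₂ : ∀ t s, |g₂ t s| ≤ M) (hh₂ : ∀ t s, |h₂ t s| ≤ M)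
    (D2 : ∀ t s, |g₂ t s - h₂ t s| ≤ δ) {t : ℝ}
    (ht : t ∈ Icc (A - τ) A) : |G1 c A g₂ t - G1 c A h₂ t| ≤ c * ((M + M) * δ * τ) := by
  have hI := int_diff (f := fun x => g₂ x 0 ^ 2) (g := fun x => h₂ x 0 ^ 2) (C := (M + M) * δ)
    (τ := τ)
    ((cg₂.comp (continuous_id.prodMk continuous_const)).pow 2)
    ((ch₂.comp (continuous_id.prodMk continuous_const)).pow 2)
    ht.2 (by linarith [ht.1]) (by positivity)
    (fun x => by
      simp only [pow_two]
      exact mul_diff (hg₂ _ _) (hh₂ _ _) (D2 _ _) (D2 _ _))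
  have := comb2 (b := 1) (u := 1) (v := 1) (P := 0) hc (by simp) hI
  simpa [G1] using this

lemma G2_diff (hc : 0 ≤ c) (hM : 0 ≤ M) (hN : 0 ≤ N) (hδ : 0 ≤ δ)
    (cg₂ : Continuous fun p : ℝ × ℝ => g₂ p.1 p.2)
    (ch₂ : Continuous fun p : ℝ × ℝ => h₂ p.1 p.2)
    (cg₃ : Continuous fun p : ℝ × ℝ × ℝ => g₃ p.1 p.2.1 p.2.2)
    (ch₃ : Continuous fun p : ℝ × ℝ × ℝ => h₃ p.1 p.2.1 p.2.2)
    (hg₂ : ∀ t s, |g₂ t s| ≤ M) (hh₂ : ∀ t s, |h₂ t s| ≤ M)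
    (hh₃ : ∀ t s r, |h₃ t s r| ≤ N)
    (D2 : ∀ t s, |g₂ t s - h₂ t s| ≤ δ)
    (D3 : ∀ t s r, |g₃ t s r - h₃ t s r| ≤ δ) {t s : ℝ}
    (ht : t ∈ Icc (A - τ) A) (hs : s ∈ Icc (-d) 0) :
    |G2 b c A d g₂ g₃ t s - G2 b c A d h₂ h₃ t s| ≤
      |b| * (c * ((M + M) * δ * τ)) + c * ((M + N) * δ * τ) := by
  obtain ⟨h1, h2, h3⟩ := dom2 (d := d) ht hs
  refine comb2 hc (G1_diff hc hM hδ cg₂ ch₂ hg₂ hh₂ D2 h2) ?_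
  refine int_diff ?_ ?_ h1 h3 (by positivity)
    (fun x => mul_diff (hg₂ _ _) (hh₃ _ _ _) (D2 _ _) (D3 _ _ _))
  · exact (cg₂.comp (continuous_id.prodMk continuous_const)).mul
      (cg₃.comp (g := fun p : ℝ × ℝ × ℝ => g₃ p.1 p.2.1 p.2.2)
      (f := fun x => (x, t + s - x, (0:ℝ))) (by fun_prop))
  · exact (ch₂.comp (continuous_id.prodMk continuous_const)).mul
      (ch₃.comp (g := fun p : ℝ × ℝ × ℝ => h₃ p.1 p.2.1 p.2.2)
      (f := fun x => (x, t + s - x, (0:ℝ))) (by fun_prop))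

lemma G3_diff (hc : 0 ≤ c) (hM : 0 ≤ M) (hN : 0 ≤ N) (hδ : 0 ≤ δ)
    (cg₂ : Continuous fun p : ℝ × ℝ => g₂ p.1 p.2)
    (ch₂ : Continuous fun p : ℝ × ℝ => h₂ p.1 p.2)
    (cg₃ : Continuous fun p : ℝ × ℝ × ℝ => g₃ p.1 p.2.1 p.2.2)
    (ch₃ : Continuous fun p : ℝ × ℝ × ℝ => h₃ p.1 p.2.1 p.2.2)
    (hg₂ : ∀ t s, |g₂ t s| ≤ M) (hh₂ : ∀ t s, |h₂ t s| ≤ M)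
    (hg₃ : ∀ t s r, |g₃ t s r| ≤ N) (hh₃ : ∀ t s r, |h₃ t s r| ≤ N)
    (D2 : ∀ t s, |g₂ t s - h₂ t s| ≤ δ)
    (D3 : ∀ t s r, |g₃ t s r - h₃ t s r| ≤ δ) {t s r : ℝ}
    (ht : t ∈ Icc (A - τ) A) (hs : s ∈ Icc (-d) 0) (hr : r ∈ Icc (-d) 0) :
    |G3 b c A d g₂ g₃ t s r - G3 b c A d h₂ h₃ t s r| ≤
      |b| * (|b| * (c * ((M + M) * δ * τ)) + c * ((M + N) * δ * τ)) +
        c * ((N + N) * δ * τ) := by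
  obtain ⟨h1, h2, h3⟩ := dom2 (d := d) ht (dmin hs hr)
  refine comb2 hc
    (G2_diff hc hM hN hδ cg₂ ch₂ cg₃ ch₃ hg₂ hh₂ hh₃ D2 D3 h2 (dabs hs hr)) ?_
  refine int_diff ?_ ?_ h1 h3 (by positivity)
    (fun x => mul_diff (hg₃ _ _ _) (hh₃ _ _ _) (D3 _ _ _) (D3 _ _ _))
  · exact (cg₃.comp (g := fun p : ℝ × ℝ × ℝ => g₃ p.1 p.2.1 p.2.2)
      (f := fun x => (x, t + s - x, (0:ℝ))) (by fun_prop)).mul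
      (cg₃.comp (g := fun p : ℝ × ℝ × ℝ => g₃ p.1 p.2.1 p.2.2)
      (f := fun x => (x, (0:ℝ), t + r - x)) (by fun_prop))
  · exact (ch₃.comp (g := fun p : ℝ × ℝ × ℝ => h₃ p.1 p.2.1 p.2.2)
      (f := fun x => (x, t + s - x, (0:ℝ))) (by fun_prop)).mul
      (ch₃.comp (g := fun p : ℝ × ℝ × ℝ => h₃ p.1 p.2.1 p.2.2)
      (f := fun x => (x, (0:ℝ), t + r - x)) (by fun_prop))

lemma G1_congr (hd : 0 ≤ d)
    (E2 : ∀ t ∈ Icc (A - τ) A, ∀ s ∈ Icc (-d) 0, g₂ t s = h₂ t s) {t : ℝ}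
    (ht : t ∈ Icc (A - τ) A) : G1 c A g₂ t = G1 c A h₂ t := by
  unfold G1
  congr 2
  refine intervalIntegral.integral_congr fun x hx => ?_
  rw [uIcc_of_le ht.2] at hx
  simp only [E2 x ⟨ht.1.trans hx.1, hx.2⟩ 0 ⟨by linarith, le_rfl⟩]

lemma G2_congr (hd : 0 ≤ d)
    (E2 : ∀ t ∈ Icc (A - τ) A, ∀ s ∈ Icc (-d) 0, g₂ t s = h₂ t s)
    (E3 : ∀ t ∈ Icc (A - τ) A, ∀ s ∈ Icc (-d) 0, ∀ r ∈ Icc (-d) 0, g₃ t s r = h₃ t s r) {t s : ℝ}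
    (ht : t ∈ Icc (A - τ) A) (hs : s ∈ Icc (-d) 0) :
    G2 b c A d g₂ g₃ t s = G2 b c A d h₂ h₃ t s := by
  obtain ⟨h1, h2, h3⟩ := dom2 (d := d) ht hs
  unfold G2
  rw [G1_congr hd E2 h2]
  congr 2
  refine intervalIntegral.integral_congr fun x hx => ?_
  rw [uIcc_of_le h1] at hx
  have hx' := hx.2.trans (min_le_right _ _)
  have hxI : x ∈ Icc (A - τ) A := ⟨ht.1.trans hx.1, hx.2.trans (min_le_left _ _)⟩
  have h0 : (0:ℝ) ∈ Icc (-d) 0 := ⟨by linarith, le_rfl⟩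
  simp only [E2 x hxI 0 h0, E3 x hxI (t + s - x)
    ⟨by linarith, by linarith [hs.2, hx.1]⟩ 0 h0]

lemma G3_congr (hd : 0 ≤ d)
    (E2 : ∀ t ∈ Icc (A - τ) A, ∀ s ∈ Icc (-d) 0, g₂ t s = h₂ t s)
    (E3 : ∀ t ∈ Icc (A - τ) A, ∀ s ∈ Icc (-d) 0, ∀ r ∈ Icc (-d) 0, g₃ t s r = h₃ t s r)
    {t s r : ℝ}
    (ht : t ∈ Icc (A - τ) A) (hs : s ∈ Icc (-d) 0) (hr : r ∈ Icc (-d) 0) :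
    G3 b c A d g₂ g₃ t s r = G3 b c A d h₂ h₃ t s r := by
  obtain ⟨h1, h2, h3⟩ := dom2 (d := d) ht (dmin hs hr)
  unfold G3
  rw [G2_congr hd E2 E3 h2 (dabs hs hr)]
  congr 2
  refine intervalIntegral.integral_congr fun x hx => ?_
  rw [uIcc_of_le h1] at hx
  have hx' := hx.2.trans (min_le_right _ _)
  have hxI : x ∈ Icc (A - τ) A := ⟨ht.1.trans hx.1, hx.2.trans (min_le_left _ _)⟩
  have h0 : (0:ℝ) ∈ Icc (-d) 0 := ⟨by linarith, le_rfl⟩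
  have hs' : t + s - x ∈ Icc (-d) 0 :=
    ⟨by linarith [min_le_left s r], by linarith [hs.2, hx.1]⟩
  have hr' : t + r - x ∈ Icc (-d) 0 :=
    ⟨by linarith [min_le_right s r], by linarith [hr.2, hx.1]⟩
  simp only [E3 x hxI _ hs' 0 h0, E3 x hxI 0 h0 _ hr']

end

section
variable {A d τ : ℝ}

abbrev Y2 (A d τ : ℝ) := C(Icc (A - τ) A × Icc (-d) 0, ℝ)
abbrev Y3 (A d τ : ℝ) := C(Icc (A - τ) A × Icc (-d) 0 × Icc (-d) 0, ℝ)

noncomputable def e2 (hI : A - τ ≤ A) (hJ : -d ≤ 0) (f : Y2 A d τ) (t s : ℝ) : ℝ :=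
  f (projIcc _ _ hI t, projIcc _ _ hJ s)

noncomputable def e3 (hI : A - τ ≤ A) (hJ : -d ≤ 0) (f : Y3 A d τ) (t s r : ℝ) : ℝ :=
  f (projIcc _ _ hI t, projIcc _ _ hJ s, projIcc _ _ hJ r)

lemma cont_e2 (hI : A - τ ≤ A) (hJ : -d ≤ 0) (f : Y2 A d τ) :
    Continuous fun p : ℝ × ℝ => e2 hI hJ f p.1 p.2 := by
  unfold e2
  exact f.continuous.comp ((continuous_projIcc.comp continuous_fst).prodMk
    (continuous_projIcc.comp continuous_snd))

lemma cont_e3 (hI : A - τ ≤ A) (hJ : -d ≤ 0) (f : Y3 A d τ) :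
    Continuous fun p : ℝ × ℝ × ℝ => e3 hI hJ f p.1 p.2.1 p.2.2 := by
  unfold e3
  exact f.continuous.comp ((continuous_projIcc.comp continuous_fst).prodMk
    ((continuous_projIcc.comp (continuous_fst.comp continuous_snd)).prodMk
    (continuous_projIcc.comp (continuous_snd.comp continuous_snd))))

noncomputable def Phi (b c : ℝ) (hI : A - τ ≤ A) (hJ : -d ≤ 0) (f : Y2 A d τ × Y3 A d τ) :
    Y2 A d τ × Y3 A d τ :=
  (⟨fun p => G2 b c A d (e2 hI hJ f.1) (e3 hI hJ f.2) p.1 p.2,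
    (cont_G2 (cont_e2 hI hJ f.1) (cont_e3 hI hJ f.2)).comp
      (f := fun p : Icc (A - τ) A × Icc (-d) 0 => ((p.1 : ℝ), (p.2 : ℝ))) (by fun_prop)⟩,
   ⟨fun p => G3 b c A d (e2 hI hJ f.1) (e3 hI hJ f.2) p.1 p.2.1 p.2.2,
    (cont_G3 (cont_e2 hI hJ f.1) (cont_e3 hI hJ f.2)).comp
      (f := fun p : Icc (A - τ) A × Icc (-d) 0 × Icc (-d) 0 =>
        ((p.1 : ℝ), (p.2.1 : ℝ), (p.2.2 : ℝ))) (by fun_prop)⟩)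

def ball (A d τ b : ℝ) : Set (Y2 A d τ × Y3 A d τ) :=
  {f | (∀ p, |f.1 p - b| ≤ |b| / 2) ∧ ∀ p, |f.2 p - b ^ 2| ≤ b ^ 2 / 2}

lemma isClosed_ball (b : ℝ) : IsClosed (ball A d τ b) := by
  have : ball A d τ b = (⋂ p, {f | |f.1 p - b| ≤ |b| / 2}) ∩
      ⋂ p, {f | |f.2 p - b ^ 2| ≤ b ^ 2 / 2} := by
    ext f; simp [ball]
  rw [this]
  refine IsClosed.inter (isClosed_iInter fun p => ?_) (isClosed_iInter fun p => ?_)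
  · exact isClosed_le ((((continuous_eval_const p).comp continuous_fst).sub
      continuous_const).abs) continuous_const
  · exact isClosed_le ((((continuous_eval_const p).comp continuous_snd).sub
      continuous_const).abs) continuous_const

lemma b2 {b : ℝ} (hI : A - τ ≤ A) (hJ : -d ≤ 0) {f : Y2 A d τ × Y3 A d τ}
    (hf : f ∈ ball A d τ b) (t s : ℝ) : |e2 hI hJ f.1 t s| ≤ 3 / 2 * |b| := by
  have := bound_of (hf.1 (projIcc _ _ hI t, projIcc _ _ hJ s))
  unfold e2; linarith

lemma b3 {b : ℝ} (hI : A - τ ≤ A) (hJ : -d ≤ 0) {f : Y2 A d τ × Y3 A d τ}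
    (hf : f ∈ ball A d τ b) (t s r : ℝ) : |e3 hI hJ f.2 t s r| ≤ 3 / 2 * b ^ 2 := by
  have := bound_of (hf.2 (projIcc _ _ hI t, projIcc _ _ hJ s, projIcc _ _ hJ r))
  rw [abs_of_nonneg (sq_nonneg b)] at this
  unfold e3; linarith

lemma mapsTo_Phi {b c : ℝ} (hc : 0 ≤ c) (hI : A - τ ≤ A) (hJ : -d ≤ 0)
    (hτ : 3 * (c * (9 / 4 * b ^ 2 * τ)) ≤ 1 / 2) :
    MapsTo (Phi (A := A) (τ := τ) (d := d) b c hI hJ) (ball A d τ b) (ball A d τ b) := by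
  intro f hf
  have h0 : 0 ≤ c * (9 / 4 * b ^ 2 * τ) := by
    have : 0 ≤ τ := by linarith
    positivity
  refine ⟨fun p => ?_, fun p => ?_⟩
  · refine (G2_bound hc (b2 hI hJ hf) (b3 hI hJ hf) p.1.2 p.2.2).trans ?_
    rw [div_eq_mul_one_div |b|]
    exact mul_le_mul_of_nonneg_left (by linarith) (abs_nonneg b)
  · refine (G3_bound hc (b2 hI hJ hf) (b3 hI hJ hf) p.1.2 p.2.1.2 p.2.2.2).trans ?_
    rw [div_eq_mul_one_div (b ^ 2)]
    exact mul_le_mul_of_nonneg_left hτ (sq_nonneg b)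

lemma dist_Phi {b c : ℝ} (hc : 0 ≤ c) (hI : A - τ ≤ A) (hJ : -d ≤ 0)
    (hτ2 : |b| * (c * ((3 / 2 * |b| + 3 / 2 * |b|) * τ)) +
      c * ((3 / 2 * |b| + 3 / 2 * b ^ 2) * τ) ≤ 1 / 2)
    (hτ3 : |b| * (|b| * (c * ((3 / 2 * |b| + 3 / 2 * |b|) * τ)) +
      c * ((3 / 2 * |b| + 3 / 2 * b ^ 2) * τ)) +
      c * ((3 / 2 * b ^ 2 + 3 / 2 * b ^ 2) * τ) ≤ 1 / 2)
    {f g : Y2 A d τ × Y3 A d τ} (hf : f ∈ ball A d τ b) (hg : g ∈ ball A d τ b) :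
    dist (Phi b c hI hJ f) (Phi b c hI hJ g) ≤ 1 / 2 * dist f g := by
  have hδ : 0 ≤ dist f g := dist_nonneg
  have D2 : ∀ t s, |e2 hI hJ f.1 t s - e2 hI hJ g.1 t s| ≤ dist f g := fun t s =>
    (ContinuousMap.dist_apply_le_dist (f := f.1) (g := g.1) _).trans (le_max_left _ _)
  have D3 : ∀ t s r, |e3 hI hJ f.2 t s r - e3 hI hJ g.2 t s r| ≤ dist f g := fun t s r =>
    (ContinuousMap.dist_apply_le_dist (f := f.2) (g := g.2) _).trans (le_max_right _ _)
  have hM : 0 ≤ 3 / 2 * |b| := by positivity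
  have hN : 0 ≤ 3 / 2 * b ^ 2 := by positivity
  refine max_le ?_ ?_
  · refine (ContinuousMap.dist_le (by positivity)).2 fun p => ?_
    refine (G2_diff hc hM hN hδ (cont_e2 hI hJ _) (cont_e2 hI hJ _) (cont_e3 hI hJ _)
      (cont_e3 hI hJ _) (b2 hI hJ hf) (b2 hI hJ hg) (b3 hI hJ hg) D2 D3
      p.1.2 p.2.2).trans ?_
    have := mul_le_mul_of_nonneg_right hτ2 hδ
    refine le_trans (le_of_eq ?_) this
    ring
  · refine (ContinuousMap.dist_le (by positivity)).2 fun p => ?_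
    refine (G3_diff hc hM hN hδ (cont_e2 hI hJ _) (cont_e2 hI hJ _) (cont_e3 hI hJ _)
      (cont_e3 hI hJ _) (b2 hI hJ hf) (b2 hI hJ hg) (b3 hI hJ hf) (b3 hI hJ hg) D2 D3
      p.1.2 p.2.1.2 p.2.2.2).trans ?_
    have := mul_le_mul_of_nonneg_right hτ3 hδ
    refine le_trans (le_of_eq ?_) this
    ring

lemma exists_fixed {b c : ℝ} (hI : A - τ ≤ A) (hJ : -d ≤ 0)
    (hmap : MapsTo (Phi (A := A) (τ := τ) (d := d) b c hI hJ) (ball A d τ b) (ball A d τ b))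
    (hdist : ∀ f ∈ ball A d τ b, ∀ g ∈ ball A d τ b,
      dist (Phi b c hI hJ f) (Phi b c hI hJ g) ≤ 1 / 2 * dist f g) :
    ∃ f ∈ ball A d τ b, Phi b c hI hJ f = f := by
  have hK : ContractingWith (1 / 2 : NNReal) (hmap.restrict _ _ _) := by
    refine ⟨by rw [← NNReal.coe_lt_coe]; norm_num, LipschitzWith.of_dist_le_mul fun x y => ?_⟩
    have := hdist x x.2 y y.2
    simpa [Subtype.dist_eq] using this
  have h0 : ((ContinuousMap.const _ b, ContinuousMap.const _ (b ^ 2)) : Y2 A d τ × Y3 A d τ) ∈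
      ball A d τ b := by
    refine ⟨fun p => ?_, fun p => ?_⟩
    · simp; positivity
    · simp; positivity
  obtain ⟨f, hf, hfix, -⟩ := hK.exists_fixedPoint' (isClosed_ball b).isComplete hmap h0
    (edist_ne_top _ _)
  exact ⟨f, hf, hfix⟩

end

lemma exists_tau {d : ℝ} (hd : 0 < d) (P Q R : ℝ) (hP : 0 ≤ P) (hQ : 0 ≤ Q) (hR : 0 ≤ R) :
    ∃ τ : ℝ, 0 < τ ∧ τ ≤ d ∧ P * τ ≤ 1 / 2 ∧ Q * τ ≤ 1 / 2 ∧ R * τ ≤ 1 / 2 := by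
  set S := 1 + P + Q + R with hS
  have hSpos : 0 < 2 * S := by positivity
  refine ⟨min d (1 / (2 * S)), by positivity, min_le_left _ _, ?_⟩
  have h1 : min d (1 / (2 * S)) ≤ 1 / (2 * S) := min_le_right _ _
  have h0 : 0 ≤ min d (1 / (2 * S)) := by positivity
  have h2 : S * min d (1 / (2 * S)) ≤ 1 / 2 := by
    calc S * min d (1 / (2 * S)) ≤ S * (1 / (2 * S)) := by gcongr
      _ = 1 / 2 := by
        have : S ≠ 0 := by positivity
        field_simp
  refine ⟨?_, ?_, ?_⟩ <;> refine le_trans (mul_le_mul_of_nonneg_right ?_ h0) h2 <;> linarith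

end FirstSlice

/-- For some `τ ∈ (0, d]`, the first-slice integral system admits a
solution in the ball `B_τ`, unique within `B_τ`. -/
theorem stmt_4 (b σ d T : ℝ) (hσ : σ ≠ 0) (hd : 0 < d) (hT : 2 * d ≤ T) :
    ∃ τ : ℝ, 0 < τ ∧ τ ≤ d ∧
      ∃ (ξ₁ : ℝ → ℝ) (ξ₂ : ℝ → ℝ → ℝ) (ξ₃ : ℝ → ℝ → ℝ → ℝ),
        memBall b T d τ ξ₁ ξ₂ ξ₃ ∧ isSolutionOn b σ T d τ ξ₁ ξ₂ ξ₃ ∧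
        ∀ (ξ₁' : ℝ → ℝ) (ξ₂' : ℝ → ℝ → ℝ) (ξ₃' : ℝ → ℝ → ℝ → ℝ),
          memBall b T d τ ξ₁' ξ₂' ξ₃' → isSolutionOn b σ T d τ ξ₁' ξ₂' ξ₃' →
            (∀ t ∈ Icc (T - d - τ) (T - d), ξ₁' t = ξ₁ t) ∧
            (∀ t ∈ Icc (T - d - τ) (T - d), ∀ s ∈ Icc (-d) 0, ξ₂' t s = ξ₂ t s) ∧
            (∀ t ∈ Icc (T - d - τ) (T - d), ∀ s ∈ Icc (-d) 0, ∀ r ∈ Icc (-d) 0,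
              ξ₃' t s r = ξ₃ t s r) := by
  have hc : 0 ≤ (σ ^ 2)⁻¹ := by positivity
  set c := (σ ^ 2)⁻¹ with hcdef
  set A := T - d with hA
  obtain ⟨τ, hτ0, hτd, hP, hQ, hR⟩ := FirstSlice.exists_tau hd
    (3 * (c * (9 / 4 * b ^ 2)))
    (|b| * (c * (3 / 2 * |b| + 3 / 2 * |b|)) + c * (3 / 2 * |b| + 3 / 2 * b ^ 2))
    (|b| * (|b| * (c * (3 / 2 * |b| + 3 / 2 * |b|)) + c * (3 / 2 * |b| + 3 / 2 * b ^ 2)) +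
      c * (3 / 2 * b ^ 2 + 3 / 2 * b ^ 2)) (by positivity) (by positivity) (by positivity)
  have hI : A - τ ≤ A := by linarith
  have hJ : -d ≤ 0 := by linarith
  have h0 : (0:ℝ) ∈ Icc (-d) 0 := ⟨hJ, le_rfl⟩
  have hmap := FirstSlice.mapsTo_Phi (A := A) (b := b) hc hI hJ (le_trans (le_of_eq (by ring)) hP)
  have hdist : ∀ f ∈ FirstSlice.ball A d τ b, ∀ g ∈ FirstSlice.ball A d τ b,
      dist (FirstSlice.Phi b c hI hJ f) (FirstSlice.Phi b c hI hJ g) ≤ 1 / 2 * dist f g :=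
    fun f hf g hg => FirstSlice.dist_Phi hc hI hJ
      (le_trans (le_of_eq (by ring)) hQ) (le_trans (le_of_eq (by ring)) hR) hf hg
  obtain ⟨f, hf, hfix⟩ := FirstSlice.exists_fixed hI hJ hmap hdist
  have F2 : ∀ t ∈ Icc (A - τ) A, ∀ s ∈ Icc (-d) 0, FirstSlice.e2 hI hJ f.1 t s =
      FirstSlice.G2 b c A d (FirstSlice.e2 hI hJ f.1) (FirstSlice.e3 hI hJ f.2) t s := by
    intro t ht s hs
    have := DFunLike.congr_fun (congrArg Prod.fst hfix) (⟨t, ht⟩, ⟨s, hs⟩)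
    unfold FirstSlice.e2 at *
    rw [projIcc_of_mem hI ht, projIcc_of_mem hJ hs]
    exact this.symm
  have F3 : ∀ t ∈ Icc (A - τ) A, ∀ s ∈ Icc (-d) 0, ∀ r ∈ Icc (-d) 0,
      FirstSlice.e3 hI hJ f.2 t s r =
      FirstSlice.G3 b c A d (FirstSlice.e2 hI hJ f.1) (FirstSlice.e3 hI hJ f.2) t s r := by
    intro t ht s hs r hr
    have := DFunLike.congr_fun (congrArg Prod.snd hfix) (⟨t, ht⟩, ⟨s, hs⟩, ⟨r, hr⟩)
    unfold FirstSlice.e3 at *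
    rw [projIcc_of_mem hI ht, projIcc_of_mem hJ hs, projIcc_of_mem hJ hr]
    exact this.symm
  have hb2 := FirstSlice.b2 hI hJ hf
  refine ⟨τ, hτ0, hτd, FirstSlice.G1 c A (FirstSlice.e2 hI hJ f.1), FirstSlice.e2 hI hJ f.1,
    FirstSlice.e3 hI hJ f.2, ?_, ?_, ?_⟩
  · refine ⟨(FirstSlice.cont_G1 (FirstSlice.cont_e2 hI hJ f.1)).continuousOn,
      (FirstSlice.cont_e2 hI hJ f.1).continuousOn,
      (FirstSlice.cont_e3 hI hJ f.2).continuousOn, ?_, ?_, ?_⟩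
    · intro t ht
      refine (FirstSlice.G1_bound (b := b) hc hb2 ht).trans ?_
      have : 0 ≤ c * (9 / 4 * b ^ 2 * τ) := by positivity
      linarith
    · intro t _ s _
      exact hf.1 _
    · intro t _ s _ r _
      exact hf.2 _
  · intro t ht s hs r hr
    refine ⟨rfl, F2 t ht s hs, ?_⟩
    obtain ⟨-, h2, -⟩ := FirstSlice.dom2 (d := d) ht (FirstSlice.dmin hs hr)
    rw [F3 t ht s hs r hr, ← hA, F2 _ h2 _ (FirstSlice.dabs hs hr)]
    rfl
  · intro ξ₁ ξ₂ ξ₃ hball hsol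
    obtain ⟨-, c2, c3, -, hB2, hB3⟩ := hball
    let g : FirstSlice.Y2 A d τ × FirstSlice.Y3 A d τ :=
      (⟨fun p => ξ₂ p.1 p.2, c2.comp_continuous
        (f := fun p : Icc (A - τ) A × Icc (-d) 0 => ((p.1 : ℝ), (p.2 : ℝ))) (by fun_prop)
        (fun p => ⟨p.1.2, p.2.2⟩)⟩,
       ⟨fun p => ξ₃ p.1 p.2.1 p.2.2, c3.comp_continuous
        (f := fun p : Icc (A - τ) A × Icc (-d) 0 × Icc (-d) 0 =>
          ((p.1 : ℝ), (p.2.1 : ℝ), (p.2.2 : ℝ))) (by fun_prop)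
        (fun p => ⟨p.1.2, p.2.1.2, p.2.2.2⟩)⟩)
    have hg : g ∈ FirstSlice.ball A d τ b :=
      ⟨fun p => hB2 _ p.1.2 _ p.2.2, fun p => hB3 _ p.1.2 _ p.2.1.2 _ p.2.2.2⟩
    have E2 : ∀ t ∈ Icc (A - τ) A, ∀ s ∈ Icc (-d) 0,
        FirstSlice.e2 hI hJ g.1 t s = ξ₂ t s := by
      intro t ht s hs
      unfold FirstSlice.e2
      rw [projIcc_of_mem hI ht, projIcc_of_mem hJ hs]
      rfl
    have E3 : ∀ t ∈ Icc (A - τ) A, ∀ s ∈ Icc (-d) 0, ∀ r ∈ Icc (-d) 0,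
        FirstSlice.e3 hI hJ g.2 t s r = ξ₃ t s r := by
      intro t ht s hs r hr
      unfold FirstSlice.e3
      rw [projIcc_of_mem hI ht, projIcc_of_mem hJ hs, projIcc_of_mem hJ hr]
      rfl
    have S1 : ∀ t ∈ Icc (A - τ) A, ξ₁ t = FirstSlice.G1 c A ξ₂ t :=
      fun t ht => (hsol t ht 0 h0 0 h0).1
    have S2 : ∀ t ∈ Icc (A - τ) A, ∀ s ∈ Icc (-d) 0,
        ξ₂ t s = FirstSlice.G2 b c A d ξ₂ ξ₃ t s := by
      intro t ht s hs
      obtain ⟨-, h2, -⟩ := FirstSlice.dom2 (d := d) ht hs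
      unfold FirstSlice.G2
      rw [← S1 _ h2]
      exact (hsol t ht s hs 0 h0).2.1
    have S3 : ∀ t ∈ Icc (A - τ) A, ∀ s ∈ Icc (-d) 0, ∀ r ∈ Icc (-d) 0,
        ξ₃ t s r = FirstSlice.G3 b c A d ξ₂ ξ₃ t s r := by
      intro t ht s hs r hr
      obtain ⟨-, h2, -⟩ := FirstSlice.dom2 (d := d) ht (FirstSlice.dmin hs hr)
      unfold FirstSlice.G3
      rw [← S2 _ h2 _ (FirstSlice.dabs hs hr)]
      exact (hsol t ht s hs r hr).2.2
    have hgfix : FirstSlice.Phi b c hI hJ g = g := by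
      refine Prod.ext (ContinuousMap.ext fun p => ?_) (ContinuousMap.ext fun p => ?_)
      · exact (FirstSlice.G2_congr hd.le E2 E3 p.1.2 p.2.2).trans (S2 _ p.1.2 _ p.2.2).symm
      · exact (FirstSlice.G3_congr hd.le E2 E3 p.1.2 p.2.1.2 p.2.2.2).trans
          (S3 _ p.1.2 _ p.2.1.2 _ p.2.2.2).symm
    have hgf : g = f := by
      have := hdist g hg f hf
      rw [hgfix, hfix] at this
      have h' : dist g f ≤ 0 := by linarith
      exact dist_le_zero.1 h'
    rw [hgf] at E2 E3
    refine ⟨fun t ht => ?_, fun t ht s hs => (E2 t ht s hs).symm,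
      fun t ht s hs r hr => (E3 t ht s hs r hr).symm⟩
    rw [S1 t ht, FirstSlice.G1_congr hd.le E2 ht]
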